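/- If S ⊆ κ is r-admissible and f : C → ℝ is continuous with f ≥ 0, then the function φ : X_S → ℝ defined by φ(x) = sup{f(r(y)) : y ∈ C, y↾S = x} is continuous on X_S. -/

import Mathlib

/-- A set `S` of indices is `r`-admissible if `x↾S = x'↾S` implies `r(x)↾S = r(x')↾S`. -/
def Admissible {κ : Type*} {C : κ → Type*} (r : (∀ α, C α) → ∀ α, C α) (S : Set κ) : Prop :=
  ∀ x x' : ∀ α, C α, S.restrict x = S.restrict x' → S.restrict (r x) = S.restrict (r x')

/-- `X_S`, the image of `X` under the coordinate projection `pr_S`. -/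
def XS {κ : Type*} {C : κ → Type*} (X : Set (∀ α, C α)) (S : Set κ) : Set (∀ α : S, C α) :=
  S.restrict '' X

/-- `p_S : X → X_S`, the restriction of the coordinate projection. -/
def pS {κ : Type*} {C : κ → Type*} (X : Set (∀ α, C α)) (S : Set κ) (x : X) : XS X S :=
  ⟨S.restrict x.1, x.1, x.2, rfl⟩

/-- For `A ⊆ B`, the bonding map `p^B_A : X_B → X_A`, restriction of coordinates. -/
def pBA {κ : Type*} {C : κ → Type*} (X : Set (∀ α, C α)) {A B : Set κ} (hAB : A ⊆ B)
    (y : XS X B) : XS X A :=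
  ⟨fun α => y.1 ⟨α.1, hAB α.2⟩, by
    obtain ⟨x, hx, hxy⟩ := y.2
    exact ⟨x, hx, by rw [← hxy]; rfl⟩⟩

open Classical in
/-- The point of the product that agrees with `x` on `S` and with `z` off `S`. -/
noncomputable def glue {κ : Type*} {C : κ → Type*} (S : Set κ) (x : ∀ α : S, C α)
    (z : ∀ α, C α) : ∀ α, C α :=
  fun α => if h : α ∈ S then x ⟨α, h⟩ else z α

theorem restrict_glue {κ : Type*} {C : κ → Type*} (S : Set κ) (x : ∀ α : S, C α)
    (z : ∀ α, C α) : S.restrict (glue S x z) = x := by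
  funext α
  exact dif_pos α.2

theorem glue_restrict_self {κ : Type*} {C : κ → Type*} (S : Set κ) (z : ∀ α, C α) :
    glue S (S.restrict z) z = z := by
  funext α
  by_cases h : α ∈ S
  · exact dif_pos h
  · exact dif_neg h

theorem continuous_glue {κ : Type*} {C : κ → Type*} [∀ α, TopologicalSpace (C α)] (S : Set κ) :
    Continuous fun p : (∀ α : S, C α) × (∀ α, C α) => glue S p.1 p.2 := by
  refine continuous_pi fun α => ?_
  by_cases h : α ∈ S
  · simp only [glue, h, dif_pos]
    fun_prop
  · simp only [glue, h, dif_neg, not_false_eq_true]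
    fun_prop

/-- The fibre of the projection over `x` is parametrised by the whole product via `glue`. -/
theorem image_glue_univ {κ : Type*} {C : κ → Type*} (S : Set κ) (x : ∀ α : S, C α) :
    glue S x '' Set.univ = {y | S.restrict y = x} := by
  ext y
  constructor
  · rintro ⟨z, -, rfl⟩
    exact restrict_glue S x z
  · rintro rfl
    exact ⟨y, trivial, glue_restrict_self S y⟩

/-- If `S` is `r`-admissible and `f : C → ℝ` is continuous and nonnegative,
then `φ : X_S → ℝ`, `φ(x) = sup {f(r(y)) : y↾S = x}`, is continuous. -/
theorem statement14 {κ : Type*} {C : κ → Type*} [∀ α, MetricSpace (C α)]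
    [∀ α, CompactSpace (C α)] [∀ α, Nonempty (C α)]
    {X : Set (∀ α, C α)} {r : (∀ α, C α) → ∀ α, C α}
    (hr : Continuous r) (hrX : ∀ z, r z ∈ X) (hfix : ∀ x ∈ X, r x = x)
    {S : Set κ} (hS : Admissible r S)
    (f : (∀ α, C α) → ℝ) (hf : Continuous f) (hf0 : ∀ y, 0 ≤ f y) :
    Continuous fun x : XS X S =>
      sSup ((fun y : ∀ α, C α => f (r y)) '' {y | S.restrict y = x.1}) := by
  simp only [← image_glue_univ, Set.image_image]
  refine isCompact_univ.continuous_sSup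
    (f := fun (x : XS X S) (z : ∀ α, C α) => f (r (glue S x.1 z))) ?_
  exact hf.comp (hr.comp ((continuous_glue S).comp
    ((continuous_subtype_val.comp continuous_fst).prodMk continuous_snd)))
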